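/- Let V be a Volterra operator on S. Then V is Lipschitz with constant 3 with respect to the ℓ¹-norm on S: for all x, y ∈ S, ‖V(x) − V(y)‖₁ ≤ 3·‖x − y‖₁. -/

import Mathlib

/-- The infinite-dimensional simplex `S ⊂ ℓ¹(ℕ)`. -/
def simplexS : Set (ℕ → ℝ) :=
  {x | (∀ i, 0 ≤ x i) ∧ Summable x ∧ ∑' i, x i = 1}

/-- The Volterra operator associated with a matrix `a`:
`(V x)_k = x_k (1 + Σ_i a k i · x_i)`. -/
noncomputable def volterra (a : ℕ → ℕ → ℝ) (x : ℕ → ℝ) : ℕ → ℝ :=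
  fun k => x k * (1 + ∑' i, a k i * x i)

/-- A row with entries bounded by `1` pairs absolutely summably with a summable family. -/
lemma summable_bounded_mul {b z : ℕ → ℝ} (hb : ∀ i, |b i| ≤ 1) (hz : Summable z) :
    Summable fun i => b i * z i :=
  Summable.of_norm_bounded hz.abs fun i => by
    rw [Real.norm_eq_abs, abs_mul]
    exact mul_le_of_le_one_left (abs_nonneg _) (hb i)

/-- Pairing with a row bounded by `1` is bounded by the `ℓ¹`-norm. -/
lemma abs_tsum_bounded_mul_le {b z : ℕ → ℝ} (hb : ∀ i, |b i| ≤ 1) (hz : Summable z) :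
    |∑' i, b i * z i| ≤ ∑' i, |z i| := by
  rw [← Real.norm_eq_abs]
  refine tsum_of_norm_bounded hz.abs.hasSum fun i => ?_
  rw [Real.norm_eq_abs, abs_mul]
  exact mul_le_of_le_one_left (abs_nonneg _) (hb i)

/-- Coordinatewise estimate for the difference of two values of a Volterra operator. -/
lemma abs_volterra_sub_le {a : ℕ → ℕ → ℝ} (hbound : ∀ k i, |a k i| ≤ 1)
    {x y : ℕ → ℝ} (hx : x ∈ simplexS) (hy : y ∈ simplexS) (k : ℕ) :
    |volterra a x k - volterra a y k| ≤ 2 * |x k - y k| + y k * ∑' i, |x i - y i| := by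
  obtain ⟨hx0, hxs, hx1⟩ := hx
  obtain ⟨hy0, hys, -⟩ := hy
  have hrow : |∑' i, a k i * x i| ≤ 1 := by
    simpa only [abs_of_nonneg (hx0 _), hx1] using abs_tsum_bounded_mul_le (hbound k) hxs
  have hdiff : |∑' i, a k i * x i - ∑' i, a k i * y i| ≤ ∑' i, |x i - y i| := by
    rw [← (summable_bounded_mul (hbound k) hxs).tsum_sub (summable_bounded_mul (hbound k) hys)]
    simpa only [mul_sub] using abs_tsum_bounded_mul_le (hbound k) (hxs.sub hys)
  have hfactor : |1 + ∑' i, a k i * x i| ≤ 2 := by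
    rw [abs_le] at hrow ⊢
    constructor <;> linarith
  have hsplit : volterra a x k - volterra a y k =
      (1 + ∑' i, a k i * x i) * (x k - y k)
        + y k * (∑' i, a k i * x i - ∑' i, a k i * y i) := by
    simp only [volterra]
    ring
  rw [hsplit]
  refine (abs_add_le _ _).trans (add_le_add ?_ ?_)
  · rw [abs_mul]
    exact mul_le_mul_of_nonneg_right hfactor (abs_nonneg _)
  · rw [abs_mul, abs_of_nonneg (hy0 k)]
    exact mul_le_mul_of_nonneg_left hdiff (hy0 k)

/-- Lemma 6.6: every Volterra operator is 3-Lipschitz on `S` with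
respect to the `ℓ¹`-norm: `‖V(x) − V(y)‖₁ ≤ 3‖x − y‖₁`. -/
theorem stmt18 (a : ℕ → ℕ → ℝ)
    (hskew : ∀ k i, a k i = -(a i k))
    (hbound : ∀ k i, |a k i| ≤ 1)
    (x y : ℕ → ℝ) (hx : x ∈ simplexS) (hy : y ∈ simplexS) :
    ∑' k, |volterra a x k - volterra a y k| ≤ 3 * ∑' k, |x k - y k| := by
  have hd : Summable fun k => |x k - y k| := (hx.2.1.sub hy.2.1).abs
  have hsum : HasSum (fun k => 2 * |x k - y k| + y k * ∑' i, |x i - y i|)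
      (2 * ∑' k, |x k - y k| + 1 * ∑' k, |x k - y k|) := by
    refine (hd.hasSum.mul_left 2).add (HasSum.mul_right _ ?_)
    simpa only [hy.2.2] using hy.2.1.hasSum
  calc ∑' k, |volterra a x k - volterra a y k|
      ≤ 2 * ∑' k, |x k - y k| + 1 * ∑' k, |x k - y k| := by
        rw [← hsum.tsum_eq]
        have hle := abs_volterra_sub_le hbound hx hy
        exact (Summable.of_nonneg_of_le (fun _ => abs_nonneg _) hle hsum.summable).tsum_le_tsum
          hle hsum.summable
    _ = 3 * ∑' k, |x k - y k| := by ring
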